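/- Assume condition (C). There exists a constant C > 0 such that for every n ≥ 1, P( P_n'(1) = 0 and P_n'(−1) = 0 ) ≤ C·n^{−3}. -/

import Mathlib

open MeasureTheory

/-- The polynomial `∑_{j=0}^n a_j z^j` with integer coefficients, viewed over `ℂ`. -/
noncomputable def polyOf (n : ℕ) (a : Fin (n + 1) → ℤ) : Polynomial ℂ :=
  ∑ j : Fin (n + 1), Polynomial.C (a j : ℂ) * Polynomial.X ^ (j : ℕ)

noncomputable def eC (x : ℝ) : ℂ := Complex.exp ((2 * Real.pi * x : ℝ) * Complex.I)

lemma eC_cont : Continuous eC := by unfold eC; fun_prop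

lemma eC_add (x y : ℝ) : eC (x + y) = eC x * eC y := by
  unfold eC; rw [← Complex.exp_add]; congr 1; push_cast; ring

lemma eC_sum {ι : Type*} (s : Finset ι) (f : ι → ℝ) : eC (∑ i ∈ s, f i) = ∏ i ∈ s, eC (f i) := by
  unfold eC; rw [← Complex.exp_sum]; congr 1; push_cast; rw [Finset.mul_sum, Finset.sum_mul]

lemma eC_int (k : ℤ) : ∫ θ in (0:ℝ)..1, eC (k * θ) = if k = 0 then 1 else 0 := by
  split_ifs with h
  · simp [h, eC]
  · have hc : (2 * Real.pi * k * Complex.I : ℂ) ≠ 0 := by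
      simp [Real.pi_ne_zero, h]
    have := integral_exp_mul_complex (a := 0) (b := 1) hc
    have h2 : ∀ θ : ℝ, eC (k * θ) = Complex.exp (2 * Real.pi * k * Complex.I * θ) := by
      intro θ; unfold eC; congr 1; push_cast; ring
    simp_rw [h2]
    rw [this]
    have h3 : Complex.exp (2 * Real.pi * k * Complex.I * (1:ℝ)) = 1 := by
      rw [Complex.exp_eq_one_iff]; exact ⟨k, by push_cast; ring⟩
    rw [h3]; simp

lemma phi_bound (p q r : ℝ) (hp : 0 ≤ p) (hq : 0 ≤ q) (hr : 0 ≤ r) (hs : p + q + r = 1)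
    (t : ℝ) :
    ‖(p : ℂ) * eC (-t) + q + r * eC t‖ ≤
      Real.exp (-((q * (1 - q) + 4 * p * r) / 2) * Real.sin (2 * Real.pi * t) ^ 2) := by
  set c := q * (1 - q) + 4 * p * r with hc
  set x := Real.pi * t with hx
  have hsq : ‖(p : ℂ) * eC (-t) + q + r * eC t‖ ^ 2 ≤ 1 - c * Real.sin (2 * x) ^ 2 := by
    have e1 : (p : ℂ) * eC (-t) + q + r * eC t =
        ((q + (p + r) * Real.cos (2 * x) : ℝ) : ℂ) +
          (((r - p) * Real.sin (2 * x) : ℝ) : ℂ) * Complex.I := by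
      unfold eC
      rw [Complex.exp_mul_I, Complex.exp_mul_I, ← Complex.ofReal_cos, ← Complex.ofReal_sin,
        ← Complex.ofReal_cos, ← Complex.ofReal_sin]
      have a1 : 2 * Real.pi * -t = -(2 * x) := by rw [hx]; ring
      have a2 : 2 * Real.pi * t = 2 * x := by rw [hx]; ring
      rw [a1, a2, Real.cos_neg, Real.sin_neg]
      push_cast; ring
    rw [e1, Complex.sq_norm, Complex.normSq_add_mul_I, Real.cos_two_mul, Real.sin_two_mul]
    have h1 : Real.sin x ^ 2 = 1 - Real.cos x ^ 2 := by
      have := Real.sin_sq_add_cos_sq x; linarith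
    have hq1 : q = 1 - p - r := by linarith
    have e2 : (2 * Real.sin x * Real.cos x) ^ 2 = 4 * (1 - Real.cos x ^ 2) * Real.cos x ^ 2 := by
      rw [← h1]; ring
    have e3 : ((r - p) * (2 * Real.sin x * Real.cos x)) ^ 2
      = (r - p) ^ 2 * (4 * (1 - Real.cos x ^ 2) * Real.cos x ^ 2) := by rw [mul_pow, e2]
    rw [e3, e2, hc]
    set y := Real.cos x ^ 2 with hy
    have hy0 : 0 ≤ y := sq_nonneg _
    have hy1 : 0 ≤ 1 - y := by rw [← h1]; positivity
    have key : 0 ≤ (q * (p + r)) * (1 - y) ^ 2 := by positivity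
    subst hq1
    nlinarith [key]
  have h2 : ‖(p : ℂ) * eC (-t) + q + r * eC t‖ ^ 2 ≤
      (Real.exp (-(c / 2) * Real.sin (2 * Real.pi * t) ^ 2)) ^ 2 := by
    rw [← Real.exp_nat_mul]
    refine hsq.trans ?_
    have := Real.add_one_le_exp (-(c * Real.sin (2 * x) ^ 2))
    have e : 2 * x = 2 * Real.pi * t := by rw [hx]; ring
    rw [e] at this ⊢
    have e' : ((2:ℕ):ℝ) * (-(c / 2) * Real.sin (2 * Real.pi * t) ^ 2)
      = -(c * Real.sin (2 * Real.pi * t) ^ 2) := by push_cast; ring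
    rw [e']; linarith
  exact (pow_le_pow_iff_left₀ (norm_nonneg _) (Real.exp_pos _).le two_ne_zero).1 h2

noncomputable def T (h : ℕ) (u : ℝ) : ℝ := ∑ d ∈ Finset.range h, Real.sin (Real.pi * (d + 1) * u) ^ 2

lemma T_cont (h : ℕ) : Continuous (T h) := by unfold T; fun_prop

lemma dirichlet (h : ℕ) (x : ℝ) :
    2 * Real.sin x * ∑ d ∈ Finset.range h, Real.cos (2 * ((d + 1) * x)) =
      Real.sin ((2 * h + 1) * x) - Real.sin x := by
  induction h with
  | zero => simp
  | succ k ih =>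
    rw [Finset.sum_range_succ, mul_add, ih]
    have a1 : ((2 * (k + 1 : ℕ) + 1 : ℝ)) * x = 2 * ((k + 1) * x) + x := by push_cast; ring
    have a2 : ((2 * k + 1 : ℝ)) * x = 2 * ((k + 1) * x) - x := by ring
    rw [a1, a2, Real.sin_add, Real.sin_sub]; ring

lemma sum_sq_lower (h : ℕ) : (h : ℝ) ^ 3 / 3 ≤ ∑ d ∈ Finset.range h, ((d : ℝ) + 1) ^ 2 := by
  induction h with
  | zero => simp
  | succ k ih =>
    rw [Finset.sum_range_succ]; push_cast
    have : (0:ℝ) ≤ k := Nat.cast_nonneg k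
    nlinarith

lemma T_lower_pos (h : ℕ) (hh : 1 ≤ h) (u : ℝ) (hu0 : 0 ≤ u) (hu : u ≤ 1 / 2) :
    (h : ℝ) / 4 ≤ T h u ∨ (h : ℝ) ^ 3 * u ^ 2 ≤ T h u := by
  have hp : (0 : ℝ) < h := by exact_mod_cast hh
  rcases le_total (u * (2 * h)) 1 with h1 | h1
  · right
    have : ∀ d ∈ Finset.range h, 4 * u ^ 2 * ((d : ℝ) + 1) ^ 2 ≤
        Real.sin (Real.pi * (d + 1) * u) ^ 2 := by
      intro d hd
      have hd' : (d : ℝ) + 1 ≤ h := by exact_mod_cast Finset.mem_range.1 hd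
      have hd0 : (0:ℝ) ≤ (d + 1) * u := by positivity
      have hdu : (d + 1) * u ≤ 1 / 2 := by nlinarith
      have hj := Real.mul_le_sin (x := Real.pi * (d + 1) * u) (by positivity)
        (by have := Real.pi_pos; nlinarith)
      have e : 2 / Real.pi * (Real.pi * (d + 1) * u) = 2 * ((d + 1) * u) := by
        field_simp
      rw [e] at hj
      have := pow_le_pow_left₀ (by positivity) hj 2
      nlinarith
    have h2 := Finset.sum_le_sum this
    rw [← Finset.mul_sum] at h2
    have h3 := sum_sq_lower h
    unfold T
    refine le_trans ?_ h2
    have : 0 ≤ u ^ 2 := sq_nonneg _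
    have : 0 ≤ (h:ℝ)^3 := by positivity
    nlinarith [mul_le_mul_of_nonneg_left h3 (show 0 ≤ 4 * u ^ 2 by positivity),
      mul_nonneg (sq_nonneg u) this]
  · left
    have hu' : 0 < u := by
      by_contra hcon
      have : u = 0 := by linarith
      rw [this] at h1; norm_num at h1
    have hj := Real.mul_le_sin (x := Real.pi * u) (by positivity)
        (by have := Real.pi_pos; nlinarith)
    have e : 2 / Real.pi * (Real.pi * u) = 2 * u := by field_simp
    rw [e] at hj
    have hd := dirichlet h (Real.pi * u)
    set Cs := ∑ d ∈ Finset.range h, Real.cos (2 * ((d + 1) * (Real.pi * u))) with hCs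
    have hT : T h u = h / 2 - Cs / 2 := by
      unfold T
      have : ∀ d ∈ Finset.range h, Real.sin (Real.pi * (d + 1) * u) ^ 2 =
          1 / 2 - Real.cos (2 * ((d + 1) * (Real.pi * u))) / 2 := by
        intro d _
        rw [Real.sin_sq_eq_half_sub]
        congr 3; ring
      rw [Finset.sum_congr rfl this, Finset.sum_sub_distrib, ← Finset.sum_div, ← Finset.sum_div, ← hCs]
      simp
    have hs1 := Real.sin_le_one ((2 * h + 1) * (Real.pi * u))
    have hCs' : Cs ≤ h / 2 := by
      by_contra hcon
      push Not at hcon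
      have : 2 * (2 * u) * (h / 2) < 1 := by
        have h5 : 2 * Real.sin (Real.pi * u) * Cs ≤ 1 - Real.sin (Real.pi * u) := by linarith
        have hs0 : 0 < Real.sin (Real.pi * u) := by linarith
        have h6 : 2 * (2 * u) * (h / 2) ≤ 2 * Real.sin (Real.pi * u) * Cs := by
          apply mul_le_mul _ hcon.le (by positivity) (by positivity)
          linarith
        linarith
      linarith
    rw [hT]; linarith

lemma T_neg (h : ℕ) (u : ℝ) : T h (-u) = T h u := by
  unfold T
  refine Finset.sum_congr rfl fun d _ => ?_
  rw [mul_neg, Real.sin_neg, neg_sq]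

lemma T_lower (h : ℕ) (hh : 1 ≤ h) (u : ℝ) (hu0 : -(1/2) ≤ u) (hu : u ≤ 1 / 2) :
    (h : ℝ) / 4 ≤ T h u ∨ (h : ℝ) ^ 3 * u ^ 2 ≤ T h u := by
  rcases le_total 0 u with h0 | h0
  · exact T_lower_pos h hh u h0 hu
  · have := T_lower_pos h hh (-u) (by linarith) (by linarith)
    rwa [T_neg, neg_sq] at this

lemma T_periodic (h : ℕ) : Function.Periodic (T h) 1 := by
  intro u
  unfold T
  refine Finset.sum_congr rfl fun d _ => ?_
  have : Real.pi * (d + 1) * (u + 1) = Real.pi * (d + 1) * u + ((d + 1 : ℕ) : ℝ) * Real.pi := by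
    push_cast; ring
  rw [this, Real.sin_add_nat_mul_pi, mul_pow, ← pow_mul, mul_comm (d+1) 2, pow_mul]
  norm_num

lemma T_int (c : ℝ) (hc : 0 < c) : ∃ K > 0, ∀ h : ℕ, 1 ≤ h →
    ∫ θ in (0:ℝ)..1, Real.exp (-c * T h (8 * θ)) ≤ K / (h * Real.sqrt h) := by
  refine ⟨32 / c ^ 2 + Real.sqrt (Real.pi / c), by positivity, fun h hh => ?_⟩
  have hp : (0 : ℝ) < h := by exact_mod_cast hh
  have hcont : Continuous fun u => Real.exp (-c * T h u) := by
    have := T_cont h; fun_prop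
  have hper : Function.Periodic (fun u => Real.exp (-c * T h u)) 1 := by
    intro u; simp only [T_periodic h u]
  have e1 : ∫ θ in (0:ℝ)..1, Real.exp (-c * T h (8 * θ)) =
      ∫ u in (-(1/2):ℝ)..(1/2), Real.exp (-c * T h u) := by
    rw [intervalIntegral.integral_comp_mul_left (fun u => Real.exp (-c * T h u)) (by norm_num)]
    have h8 := hper.intervalIntegral_add_zsmul_eq 8 0 (fun a b => hcont.intervalIntegrable a b)
    have h9 := hper.intervalIntegral_add_eq 0 (-(1/2))
    norm_num at h8 h9 ⊢
    rw [h8, h9]; ring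
  rw [e1]
  have hb : 0 < c * (h:ℝ) ^ 3 := by positivity
  have hgi := integrable_exp_neg_mul_sq hb
  have hle : ∫ u in (-(1/2):ℝ)..(1/2), Real.exp (-c * T h u) ≤
      ∫ u in (-(1/2):ℝ)..(1/2), (Real.exp (-(c * h / 4)) + Real.exp (-(c * (h:ℝ)^3) * u ^ 2)) := by
    apply intervalIntegral.integral_mono_on (by norm_num) (hcont.intervalIntegrable _ _)
    · exact Continuous.intervalIntegrable (by fun_prop) _ _
    · intro u hu
      rcases T_lower h hh u hu.1 hu.2 with h1 | h1
      · have : Real.exp (-c * T h u) ≤ Real.exp (-(c * h / 4)) := by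
          apply Real.exp_le_exp.2; nlinarith
        have := Real.exp_pos (-(c * (h:ℝ)^3) * u ^ 2)
        linarith
      · have : Real.exp (-c * T h u) ≤ Real.exp (-(c * (h:ℝ)^3) * u ^ 2) := by
          apply Real.exp_le_exp.2; nlinarith
        have := Real.exp_pos (-(c * h / 4))
        linarith
  refine hle.trans ?_
  rw [intervalIntegral.integral_add (by simp) hgi.intervalIntegrable]
  have hg : ∫ u in (-(1/2):ℝ)..(1/2), Real.exp (-(c * (h:ℝ)^3) * u ^ 2) ≤
      Real.sqrt (Real.pi / (c * (h:ℝ)^3)) := by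
    rw [← integral_gaussian, intervalIntegral.integral_of_le (by norm_num)]
    exact setIntegral_le_integral hgi (Filter.Eventually.of_forall fun u => (Real.exp_pos _).le)
  have hsq : Real.sqrt (Real.pi / (c * (h:ℝ)^3)) = Real.sqrt (Real.pi / c) / (h * Real.sqrt h) := by
    rw [← div_div, Real.sqrt_div (by positivity)]
    congr 1
    rw [pow_succ, Real.sqrt_mul (by positivity), Real.sqrt_sq hp.le]
  have hex : Real.exp (-(c * h / 4)) ≤ 32 / c ^ 2 / (h * Real.sqrt h) := by
    have h1 : 1 + (c * h / 4) + (c * h / 4) ^ 2 / 2 ≤ Real.exp (c * h / 4) :=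
      Real.quadratic_le_exp_of_nonneg (by positivity)
    have h2 : c ^ 2 * h ^ 2 / 32 ≤ Real.exp (c * h / 4) := by
      have : 0 ≤ c * h := by positivity
      nlinarith
    have h3 : Real.sqrt h ≤ h := by
      rw [Real.sqrt_le_left hp.le]
      have : (1:ℝ) ≤ h := by exact_mod_cast hh
      nlinarith
    have hs : 0 < Real.sqrt h := Real.sqrt_pos.2 hp
    rw [Real.exp_neg, div_div, inv_le_comm₀ (Real.exp_pos _) (by positivity), inv_div]
    refine le_trans ?_ h2
    gcongr
    nlinarith
  rw [hsq] at hg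
  have : ∫ u in (-(1/2):ℝ)..(1/2), Real.exp (-(c * h / 4)) = Real.exp (-(c * h / 4)) := by
    simp; norm_num
  rw [this, add_div]
  linarith

lemma pair_sum (h : ℕ) (f : ℕ → ℝ) (hf : ∀ k, 0 ≤ f k) :
    ∑ d ∈ Finset.range h, (f (h - 1 - d) + f (h + 1 + d)) ≤ ∑ k ∈ Finset.range (2 * h + 1), f k := by
  rw [Finset.sum_add_distrib, Finset.sum_range_reflect f h]
  have : 2 * h + 1 = (h + 1) + h := by ring
  rw [this, Finset.sum_range_add, Finset.sum_range_succ]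
  have := hf h
  linarith

lemma sin_diff (u v : ℝ) : Real.sin (u - v) ^ 2 ≤ 2 * (Real.sin v ^ 2 + Real.sin u ^ 2) := by
  rw [Real.sin_sub]
  have h1 := Real.sin_sq_add_cos_sq u
  have h2 := Real.sin_sq_add_cos_sq v
  have h3 : (Real.sin u * Real.cos v) ^ 2 ≤ Real.sin u ^ 2 := by
    rw [mul_pow]; nlinarith [sq_nonneg (Real.sin u), sq_nonneg (Real.sin v)]
  have h4 : (Real.cos u * Real.sin v) ^ 2 ≤ Real.sin v ^ 2 := by
    rw [mul_pow]; nlinarith [sq_nonneg (Real.sin u), sq_nonneg (Real.sin v)]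
  nlinarith [sq_nonneg (Real.sin u * Real.cos v + Real.cos u * Real.sin v)]

def wt (ε j : ℕ) : ℤ := if j % 2 = ε then j else 0

lemma sum_lower (n h ε : ℕ) (hε : ε < 2) (hn : 4 * h + 1 ≤ n) (θ : ℝ) :
    T h (8 * θ) / 2 ≤ ∑ j : Fin (n + 1), Real.sin (2 * Real.pi * (wt ε j * θ)) ^ 2 := by
  rw [Fin.sum_univ_eq_sum_range (fun j => Real.sin (2 * Real.pi * (wt ε j * θ)) ^ 2) (n + 1)]
  have h1 : ∑ k ∈ Finset.range (2 * h + 1), Real.sin (2 * Real.pi * ((2 * k + ε : ℕ) * θ)) ^ 2 ≤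
      ∑ j ∈ Finset.range (n + 1), Real.sin (2 * Real.pi * (wt ε j * θ)) ^ 2 := by
    have hinj : Set.InjOn (fun k => 2 * k + ε) (Finset.range (2 * h + 1) : Set ℕ) := by
      intro a _ b _ hab; simp only at hab; omega
    have : ∑ k ∈ Finset.range (2 * h + 1), Real.sin (2 * Real.pi * ((2 * k + ε : ℕ) * θ)) ^ 2 =
       ∑ j ∈ (Finset.range (2 * h + 1)).image (fun k => 2 * k + ε),
         Real.sin (2 * Real.pi * (wt ε j * θ)) ^ 2 := by
      rw [Finset.sum_image hinj]
      refine Finset.sum_congr rfl fun k _ => ?_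
      have : (2 * k + ε) % 2 = ε := by omega
      simp [wt, this]
    rw [this]
    apply Finset.sum_le_sum_of_subset_of_nonneg
    · intro j hj
      simp only [Finset.mem_image, Finset.mem_range] at hj ⊢
      omega
    · intros; positivity
  refine le_trans ?_ h1
  refine le_trans ?_ (pair_sum h (fun k => Real.sin (2 * Real.pi * ((2 * k + ε : ℕ) * θ)) ^ 2)
    (fun k => sq_nonneg _))
  unfold T
  rw [Finset.sum_div]
  refine Finset.sum_le_sum fun d hd => ?_
  have hd' := Finset.mem_range.1 hd
  have := sin_diff (2 * Real.pi * ((2 * (h + 1 + d) + ε : ℕ) * θ))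
    (2 * Real.pi * ((2 * (h - 1 - d) + ε : ℕ) * θ))
  have e : 2 * Real.pi * ((2 * (h + 1 + d) + ε : ℕ) * θ) -
    2 * Real.pi * ((2 * (h - 1 - d) + ε : ℕ) * θ) = Real.pi * (d + 1) * (8 * θ) := by
    obtain ⟨m, rfl⟩ : ∃ m, h = m + 1 + d := ⟨h - 1 - d, by omega⟩
    have : m + 1 + d - 1 - d = m := by omega
    rw [this]; push_cast; ring
  rw [e] at this
  linarith

noncomputable def FF (c : ℝ) (n ε : ℕ) (θ : ℝ) : ℝ :=
  Real.exp (-c * ∑ j : Fin (n + 1), Real.sin (2 * Real.pi * (wt ε j * θ)) ^ 2)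

lemma FF_cont (c : ℝ) (n ε : ℕ) : Continuous (FF c n ε) := by unfold FF; fun_prop

lemma FF_int (c : ℝ) (hc : 0 < c) (n h ε : ℕ) (hε : ε < 2) (hn : 4 * h + 1 ≤ n) :
    ∫ θ in (0:ℝ)..1, FF c n ε θ ≤ ∫ θ in (0:ℝ)..1, Real.exp (-(c / 2) * T h (8 * θ)) := by
  apply intervalIntegral.integral_mono_on (by norm_num)
    ((FF_cont c n ε).intervalIntegrable _ _)
  · have := T_cont h
    exact Continuous.intervalIntegrable (by fun_prop) _ _
  · intro θ _
    unfold FF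
    apply Real.exp_le_exp.2
    have := sum_lower n h ε hε hn θ
    nlinarith

lemma fourier_bound (p : ℤ → ℝ) (hp : ∀ x, 0 ≤ p x) (hs : p (-1) + p 0 + p 1 = 1) (n : ℕ) (c : ℝ)
    (hc : c = (p 0 * (1 - p 0) + 4 * p (-1) * p 1) / 2) :
    ∑ a ∈ Fintype.piFinset (fun _ : Fin (n + 1) => ({-1, 0, 1} : Finset ℤ)),
      (if (∑ j : Fin (n + 1), wt 1 j * a j = 0 ∧ ∑ j : Fin (n + 1), wt 0 j * a j = 0) then ∏ j, p (a j) else 0)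
    ≤ (∫ θ in (0:ℝ)..1, FF c n 1 θ) * (∫ θ in (0:ℝ)..1, FF c n 0 θ) := by
  set Ω := Fintype.piFinset (fun _ : Fin (n + 1) => ({-1, 0, 1} : Finset ℤ)) with hΩ
  have key : ((∑ a ∈ Ω,
      (if (∑ j : Fin (n + 1), wt 1 j * a j = 0 ∧ ∑ j : Fin (n + 1), wt 0 j * a j = 0) then ∏ j, p (a j) else 0) : ℝ) : ℂ)
      = ∫ θ in (0:ℝ)..1, ∫ η in (0:ℝ)..1,
        ∏ j : Fin (n + 1), ∑ x ∈ ({-1, 0, 1} : Finset ℤ),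
          ((p x : ℂ) * eC (x * (wt 1 j * θ + wt 0 j * η))) := by
    have e1 : ∀ θ η : ℝ, ∏ j : Fin (n + 1), ∑ x ∈ ({-1, 0, 1} : Finset ℤ),
          ((p x : ℂ) * eC (x * (wt 1 j * θ + wt 0 j * η))) =
        ∑ a ∈ Ω, (∏ j, (p (a j) : ℂ)) * eC ((∑ j : Fin (n + 1), wt 1 j * a j : ℤ) * θ) *
          eC ((∑ j : Fin (n + 1), wt 0 j * a j : ℤ) * η) := by
      intro θ η
      rw [Finset.prod_univ_sum]
      refine Finset.sum_congr rfl fun a _ => ?_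
      rw [Finset.prod_mul_distrib, mul_assoc, ← eC_add, ← eC_sum]
      congr 2
      push_cast
      rw [Finset.sum_mul, Finset.sum_mul, ← Finset.sum_add_distrib]
      exact Finset.sum_congr rfl fun j _ => by ring
    simp_rw [e1]
    have ec := eC_cont
    have e2 : ∀ θ : ℝ, ∫ η in (0:ℝ)..1, ∑ a ∈ Ω, (∏ j, (p (a j) : ℂ)) *
        eC ((∑ j : Fin (n + 1), wt 1 j * a j : ℤ) * θ) * eC ((∑ j : Fin (n + 1), wt 0 j * a j : ℤ) * η) =
        ∑ a ∈ Ω, (∏ j, (p (a j) : ℂ)) *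
        eC ((∑ j : Fin (n + 1), wt 1 j * a j : ℤ) * θ) * (if ∑ j : Fin (n + 1), wt 0 j * a j = 0 then 1 else 0) := by
      intro θ
      rw [intervalIntegral.integral_finsetSum]
      · refine Finset.sum_congr rfl fun a _ => ?_
        rw [intervalIntegral.integral_const_mul, eC_int]
      · intro a _
        exact Continuous.intervalIntegrable (by fun_prop) _ _
    simp_rw [e2]
    rw [intervalIntegral.integral_finsetSum]
    · rw [Complex.ofReal_sum]
      refine Finset.sum_congr rfl fun a _ => ?_
      rw [intervalIntegral.integral_mul_const, intervalIntegral.integral_const_mul, eC_int]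
      by_cases h1 : ∑ j : Fin (n + 1), wt 1 j * a j = 0 <;> by_cases h2 : ∑ j : Fin (n + 1), wt 0 j * a j = 0 <;>
        simp [h1, h2]
    · intro a _
      exact Continuous.intervalIntegrable (by fun_prop) _ _
  have hb : ∀ θ η : ℝ, ‖∏ j : Fin (n + 1), ∑ x ∈ ({-1, 0, 1} : Finset ℤ),
          ((p x : ℂ) * eC (x * (wt 1 j * θ + wt 0 j * η)))‖ ≤ FF c n 1 θ * FF c n 0 η := by
    intro θ η
    rw [norm_prod]
    unfold FF
    rw [← Real.exp_add, ← mul_add, ← Finset.sum_add_distrib, Finset.mul_sum, Real.exp_sum]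
    refine Finset.prod_le_prod (fun _ _ => norm_nonneg _) fun j _ => ?_
    have hφ := phi_bound (p (-1)) (p 0) (p 1) (hp _) (hp _) (hp _) hs (wt 1 j * θ + wt 0 j * η)
    rw [← hc] at hφ
    have e3 : ∑ x ∈ ({-1, 0, 1} : Finset ℤ), ((p x : ℂ) * eC (x * (wt 1 j * θ + wt 0 j * η))) =
      (p (-1) : ℂ) * eC (-(wt 1 j * θ + wt 0 j * η)) + p 0 + p 1 * eC (wt 1 j * θ + wt 0 j * η) := by
      rw [Finset.sum_insert (by decide), Finset.sum_insert (by decide), Finset.sum_singleton]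
      have : eC 0 = 1 := by simp [eC]
      push_cast
      rw [zero_mul, this, one_mul, neg_one_mul]; ring
    rw [e3]
    refine hφ.trans (le_of_eq ?_)
    congr 2
    rcases Nat.mod_two_eq_zero_or_one (j : ℕ) with hj | hj <;> simp [wt, hj]
  have hF1 := FF_cont c n 1
  have hF0 := FF_cont c n 0
  have hin : ∀ θ : ℝ, ‖∫ η in (0:ℝ)..1,
        ∏ j : Fin (n + 1), ∑ x ∈ ({-1, 0, 1} : Finset ℤ),
          ((p x : ℂ) * eC (x * (wt 1 j * θ + wt 0 j * η)))‖ ≤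
      FF c n 1 θ * ∫ η in (0:ℝ)..1, FF c n 0 η := by
    intro θ
    rw [← intervalIntegral.integral_const_mul]
    exact intervalIntegral.norm_integral_le_of_norm_le (by norm_num)
      (Filter.Eventually.of_forall fun η _ => hb θ η)
      (Continuous.intervalIntegrable (by fun_prop) _ _)
  have hout := intervalIntegral.norm_integral_le_of_norm_le (μ := volume) (a := 0) (b := 1)
    (by norm_num) (Filter.Eventually.of_forall fun θ _ => hin θ)
    (Continuous.intervalIntegrable (by fun_prop) _ _)
  rw [← key, intervalIntegral.integral_mul_const, Complex.norm_real] at hout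
  exact (le_abs_self _).trans hout

lemma event_wt (n : ℕ) (a : Fin (n + 1) → ℤ)
    (h1 : (Polynomial.derivative (polyOf n a)).eval 1 = 0)
    (h2 : (Polynomial.derivative (polyOf n a)).eval (-1) = 0) :
    ∑ j : Fin (n + 1), wt 1 j * a j = 0 ∧ ∑ j : Fin (n + 1), wt 0 j * a j = 0 := by
  unfold polyOf at h1 h2
  simp only [Polynomial.derivative_sum, Polynomial.derivative_C_mul_X_pow,
    Polynomial.eval_finsetSum, Polynomial.eval_mul, Polynomial.eval_C, Polynomial.eval_pow,
    Polynomial.eval_X, one_pow, mul_one] at h1 h2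
  have e1 : (2 : ℂ) * ((∑ j : Fin (n + 1), wt 1 j * a j : ℤ) : ℂ) = (∑ j : Fin (n + 1), (a j : ℂ) * (j : ℕ)) +
      ∑ j : Fin (n + 1), (a j : ℂ) * (j : ℕ) * (-1) ^ ((j : ℕ) - 1) := by
    push_cast
    rw [← Finset.sum_add_distrib, Finset.mul_sum]
    refine Finset.sum_congr rfl fun j _ => ?_
    generalize (j : ℕ) = k
    rcases Nat.even_or_odd' k with ⟨m, rfl | rfl⟩
    · rcases m with _ | m
      · simp [wt]
      · have : 2 * (m + 1) - 1 = 2 * m + 1 := by omega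
        simp [wt, this, pow_succ, pow_mul]
    · have : (2 * m + 1) % 2 = 1 := by omega
      simp [wt, this, pow_mul]; ring
  have e0 : (2 : ℂ) * ((∑ j : Fin (n + 1), wt 0 j * a j : ℤ) : ℂ) = (∑ j : Fin (n + 1), (a j : ℂ) * (j : ℕ)) -
      ∑ j : Fin (n + 1), (a j : ℂ) * (j : ℕ) * (-1) ^ ((j : ℕ) - 1) := by
    push_cast
    rw [← Finset.sum_sub_distrib, Finset.mul_sum]
    refine Finset.sum_congr rfl fun j _ => ?_
    generalize (j : ℕ) = k
    rcases Nat.even_or_odd' k with ⟨m, rfl | rfl⟩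
    · rcases m with _ | m
      · simp [wt]
      · have : 2 * (m + 1) - 1 = 2 * m + 1 := by omega
        simp [wt, this, pow_succ, pow_mul]; ring
    · have : (2 * m + 1) % 2 = 1 := by omega
      simp [wt, this, pow_mul]
  rw [h1, h2] at e1 e0
  constructor
  · have : ((∑ j : Fin (n + 1), wt 1 j * a j : ℤ) : ℂ) = 0 := by simpa using e1
    exact_mod_cast this
  · have : ((∑ j : Fin (n + 1), wt 0 j * a j : ℤ) : ℂ) = 0 := by simpa using e0
    exact_mod_cast this

lemma measure_bound (μ : MeasureTheory.Measure ℤ) [IsProbabilityMeasure μ]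
    (hsupp : μ (({-1, 0, 1} : Set ℤ)ᶜ) = 0) (n : ℕ) :
    ((Measure.pi fun _ : Fin (n + 1) => μ)
          {a | (Polynomial.derivative (polyOf n a)).eval 1 = 0 ∧
               (Polynomial.derivative (polyOf n a)).eval (-1) = 0}).toReal ≤
    ∑ a ∈ Fintype.piFinset (fun _ : Fin (n + 1) => ({-1, 0, 1} : Finset ℤ)),
      (if (∑ j : Fin (n + 1), wt 1 j * a j = 0 ∧ ∑ j : Fin (n + 1), wt 0 j * a j = 0) then ∏ j, (μ {a j}).toReal else 0) := by
  set Ω := Fintype.piFinset (fun _ : Fin (n + 1) => ({-1, 0, 1} : Finset ℤ)) with hΩ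
  set P := Measure.pi fun _ : Fin (n + 1) => μ with hP
  have hae : ∀ᵐ a ∂P, ∀ j, a j ∈ ({-1, 0, 1} : Set ℤ) := by
    rw [Filter.eventually_all]
    intro j
    exact (Measure.tendsto_eval_ae_ae (μ := fun _ : Fin (n + 1) => μ) (i := j)).eventually
      (p := fun x => x ∈ ({-1, 0, 1} : Set ℤ)) hsupp
  rw [← Finset.sum_filter]
  set G := Ω.filter (fun a => ∑ j : Fin (n + 1), wt 1 j * a j = 0 ∧ ∑ j : Fin (n + 1), wt 0 j * a j = 0) with hG
  have h1 : P {a | (Polynomial.derivative (polyOf n a)).eval 1 = 0 ∧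
               (Polynomial.derivative (polyOf n a)).eval (-1) = 0} ≤ P (⋃ a ∈ G, {a}) := by
    apply measure_mono_ae
    filter_upwards [hae] with a ha h
    have hh := event_wt n a h.1 h.2
    change a ∈ (⋃ a ∈ G, {a})
    simp only [Set.mem_iUnion, Set.mem_singleton_iff, exists_prop, exists_eq_right']
    rw [hG, Finset.mem_filter]
    refine ⟨?_, hh⟩
    rw [hΩ, Fintype.mem_piFinset]
    intro j
    simpa using ha j
  have h2 := h1.trans (measure_biUnion_finset_le G (fun a => ({a} : Set _)))
  have h3 : ∀ a, P {a} = ∏ j, μ {a j} := fun a => Measure.pi_singleton _ a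
  simp_rw [h3] at h2
  have hfin : ∀ a ∈ G, ∏ j, μ {a j} ≠ ⊤ := fun a _ =>
    ENNReal.prod_ne_top fun j _ => measure_ne_top _ _
  refine (ENNReal.toReal_mono (ENNReal.sum_ne_top.2 hfin) h2).trans (le_of_eq ?_)
  rw [ENNReal.toReal_sum hfin]
  simp_rw [ENNReal.toReal_prod]

/-- Under condition (C), the probability that both `P_n'(1) = 0` and `P_n'(-1) = 0` is at
most `C·n⁻³`. -/
theorem derivative_double_zero_prob (μ : MeasureTheory.Measure ℤ) [IsProbabilityMeasure μ]
    (hsupp : μ (({-1, 0, 1} : Set ℤ)ᶜ) = 0)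
    (hC : ∀ x ∈ ({-1, 0, 1} : Set ℤ), (μ {x}).toReal < 1 / Real.sqrt 3) :
    ∃ C > (0 : ℝ), ∀ n : ℕ, 1 ≤ n →
      ((Measure.pi fun _ : Fin (n + 1) => μ)
          {a | (Polynomial.derivative (polyOf n a)).eval 1 = 0 ∧
               (Polynomial.derivative (polyOf n a)).eval (-1) = 0}).toReal
        ≤ C * (n : ℝ) ^ (-(3 : ℝ)) := by
  set p : ℤ → ℝ := fun x => (μ {x}).toReal with hpdef
  have hp : ∀ x, 0 ≤ p x := fun x => ENNReal.toReal_nonneg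
  have hs : p (-1) + p 0 + p 1 = 1 := by
    have h1 : μ ({-1, 0, 1} : Set ℤ) = 1 := (prob_compl_eq_zero_iff (by measurability)).1 hsupp
    have h2 : ∑ x ∈ ({-1, 0, 1} : Finset ℤ), μ {x} = μ (({-1, 0, 1} : Finset ℤ) : Set ℤ) :=
      sum_measure_singleton
    have h3 : ((({-1, 0, 1} : Finset ℤ)) : Set ℤ) = {-1, 0, 1} := by simp
    rw [h3, h1] at h2
    have h4 := congrArg ENNReal.toReal h2
    rw [ENNReal.toReal_sum (fun _ _ => measure_ne_top _ _),
      Finset.sum_insert (by decide), Finset.sum_insert (by decide), Finset.sum_singleton] at h4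
    simp only [hpdef]
    rw [add_assoc, h4]; simp
  have hlt : ∀ x ∈ ({-1, 0, 1} : Set ℤ), p x < 1 := by
    intro x hx
    refine (hC x hx).trans_le ?_
    rw [div_le_one (by positivity)]
    rw [Real.one_le_sqrt]; norm_num
  have q0 := hlt 0 (by simp)
  have q1 := hlt 1 (by simp)
  have qm := hlt (-1) (by simp)
  set c := (p 0 * (1 - p 0) + 4 * p (-1) * p 1) / 2 with hc
  have hcpos : 0 < c := by
    rcases (hp 0).eq_or_lt with h0 | h0
    · have : 0 < p (-1) := by linarith
      have : 0 < p 1 := by linarith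
      rw [hc, ← h0]
      have : 0 < p (-1) * p 1 := by positivity
      linarith
    · have : 0 < p 0 * (1 - p 0) := mul_pos h0 (by linarith)
      have : 0 ≤ p (-1) * p 1 := mul_nonneg (hp _) (hp _)
      rw [hc]; linarith
  obtain ⟨K, hK, hKb⟩ := T_int (c / 2) (by positivity)
  refine ⟨512 * K ^ 2 + 64, by positivity, fun n hn => ?_⟩
  have hn0 : (0:ℝ) < n := by exact_mod_cast hn
  have hpow : (n : ℝ) ^ (-(3 : ℝ)) = 1 / (n:ℝ) ^ 3 := by
    rw [Real.rpow_neg hn0.le, one_div]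
    congr 1
    exact_mod_cast Real.rpow_natCast (n:ℝ) 3
  rw [hpow, mul_one_div]
  rcases Nat.lt_or_ge n 5 with h5 | h5
  · refine le_trans (b := 1) ?_ ?_
    · exact ENNReal.toReal_le_of_le_ofReal (by norm_num) (by simpa using prob_le_one)
    · rw [le_div_iff₀ (by positivity), one_mul]
      have h4 : (n:ℝ) ≤ 4 := by exact_mod_cast (by omega : n ≤ 4)
      have := pow_le_pow_left₀ hn0.le h4 3
      have : 0 ≤ K ^ 2 := sq_nonneg _
      linarith
  · obtain ⟨h, hh⟩ : ∃ h, h = (n - 1) / 4 := ⟨_, rfl⟩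
    have hh1 : 1 ≤ h := by omega
    have hh4 : 4 * h + 1 ≤ n := by omega
    have hh8 : n ≤ 8 * h := by omega
    have hh0 : (0:ℝ) < h := by exact_mod_cast hh1
    refine (measure_bound μ hsupp n).trans ((fourier_bound p hp hs n c hc).trans ?_)
    have b1 := (FF_int c hcpos n h 1 (by norm_num) hh4).trans (hKb h hh1)
    have b0 := (FF_int c hcpos n h 0 (by norm_num) hh4).trans (hKb h hh1)
    have n0 : 0 ≤ ∫ θ in (0:ℝ)..1, FF c n 0 θ :=
      intervalIntegral.integral_nonneg (by norm_num) fun θ _ => (Real.exp_pos _).le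
    refine (mul_le_mul b1 b0 n0 (by positivity)).trans ?_
    have e : K / (h * Real.sqrt h) * (K / (h * Real.sqrt h)) = K ^ 2 / (h:ℝ) ^ 3 := by
      rw [div_mul_div_comm]
      have := Real.mul_self_sqrt hh0.le
      congr 1
      · ring
      · calc _ = (h:ℝ) ^ 2 * (Real.sqrt h * Real.sqrt h) := by ring
          _ = _ := by rw [this]; ring
    rw [e, div_le_div_iff₀ (by positivity) (by positivity)]
    have h8 : (n:ℝ) ≤ 8 * h := by exact_mod_cast hh8
    have h9 := pow_le_pow_left₀ hn0.le h8 3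
    have h10 := mul_le_mul_of_nonneg_left h9 (sq_nonneg K)
    have : 0 < (h:ℝ) ^ 3 := by positivity
    nlinarith
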